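/- arXiv:2601.02940 — 2 statements merged into one kernel-verified Lean document; each statement's English description precedes it below -/
import Mathlib

section
/- Let ρ : G →* (ψ ≃ₗ[ℂ] ψ) be a representation of a group G on a nonzero finite-dimensional complex vector space ψ, and assume ψ is irreducible: the only submodules U of ψ with U.map(ρ g) = U for all g are ⊥ and ⊤. Equip Fin n → ψ with the diagonal G-action g • f = fun i => ρ(g)(f i). For U : Submodule ℂ (Fin n → ℂ) define Φ(U) : Submodule ℂ (Fin n → ψ) to be the span of {fun i => (c i) • v : c ∈ U, v ∈ ψ}. Then Φ is an order-preserving bijection from the set of all ℂ-subspaces of Fin n → ℂ onto the set of G-invariant subspaces of Fin n → ψ, whose inverse is also order-preserving, and moreover finrank(Φ U) = (finrank U) · (finrank ψ) for every U. -/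
/-- The diagonal action of `g : G` on `Fin n → ψ` induced by a representation
`ρ : G →* (ψ ≃ₗ[ℂ] ψ)`, as a linear map. -/
def diagMap {G ψ : Type*} [Group G] [AddCommGroup ψ] [Module ℂ ψ]
    (ρ : G →* (ψ ≃ₗ[ℂ] ψ)) (n : ℕ) (g : G) : (Fin n → ψ) →ₗ[ℂ] (Fin n → ψ) where
  toFun f := fun i => ρ g (f i)
  map_add' := by
    intro a b
    funext i
    simp
  map_smul' := by
    intro c a
    funext i
    simp

/-- For a subspace `U` of `Fin n → ℂ`, the subspace of `Fin n → ψ` spanned by the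
"decomposable" tuples `i ↦ (c i) • v` with `c ∈ U` and `v ∈ ψ`. -/
def isotypicCorrespondence (ψ : Type*) [AddCommGroup ψ] [Module ℂ ψ] (n : ℕ)
    (U : Submodule ℂ (Fin n → ℂ)) : Submodule ℂ (Fin n → ψ) :=
  Submodule.span ℂ {w : Fin n → ψ | ∃ c ∈ U, ∃ v : ψ, w = fun i => c i • v}

theorem burnside_adjoin {G ψ : Type*} [Group G] [AddCommGroup ψ] [Module ℂ ψ]
    [FiniteDimensional ℂ ψ] [Nontrivial ψ]
    (ρ : G →* (ψ ≃ₗ[ℂ] ψ))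
    (hirr : ∀ U : Submodule ℂ ψ, (∀ g : G, U.map (ρ g).toLinearMap = U) → U = ⊥ ∨ U = ⊤)
    (T : Module.End ℂ ψ) :
    T ∈ Algebra.adjoin ℂ (Set.range fun g : G => ((ρ g).toLinearMap : Module.End ℂ ψ)) := by
  set A := Algebra.adjoin ℂ (Set.range fun g : G => ((ρ g).toLinearMap : Module.End ℂ ψ)) with hA
  have hmem : ∀ g : G, ((ρ g).toLinearMap : Module.End ℂ ψ) ∈ A := fun g =>
    Algebra.subset_adjoin ⟨g, rfl⟩
  have hsimple : IsSimpleModule A ψ := by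
    rw [isSimpleModule_iff]
    refine { exists_pair_ne := ⟨⊥, ⊤, bot_ne_top⟩, eq_bot_or_eq_top := fun U => ?_ }
    have hle : ∀ g : G, ∀ x ∈ U, ρ g x ∈ U := fun g x hx =>
      U.smul_mem (⟨_, hmem g⟩ : A) hx
    have := hirr (U.restrictScalars ℂ) (fun g => by
      apply le_antisymm
      · rintro _ ⟨x, hx, rfl⟩
        exact hle g x hx
      · intro x hx
        refine ⟨ρ g⁻¹ x, hle g⁻¹ x hx, ?_⟩
        change (ρ g * ρ g⁻¹) x = x
        rw [← map_mul]
        simp)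
    simpa using this
  have hsurj := (IsSimpleModule.algebraMap_end_bijective_of_isAlgClosed (A := A) (V := ψ) ℂ).2
  let f : Module.End (Module.End A ψ) ψ :=
    { toFun := T
      map_add' := T.map_add
      map_smul' := fun e x => by
        obtain ⟨c, rfl⟩ := hsurj e
        exact T.map_smul c x }
  let b := Module.finBasis ℂ ψ
  classical
  obtain ⟨r, hr⟩ := jacobson_density (R := A) f (Finset.univ.image b)
  have : T = r.1 := b.ext fun i => hr (b i) (by simp)
  rw [this]
  exact r.2

/-- Coordinate slice `f ↦ (i ↦ b.coord k (f i))`. -/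
noncomputable def coordSlice {ψ : Type*} [AddCommGroup ψ] [Module ℂ ψ] (n : ℕ) {κ : Type*}
    (b : Module.Basis κ ℂ ψ) (k : κ) : (Fin n → ψ) →ₗ[ℂ] (Fin n → ℂ) :=
  LinearMap.pi fun i => (b.coord k).comp (LinearMap.proj i)

theorem coordSlice_apply {ψ : Type*} [AddCommGroup ψ] [Module ℂ ψ] (n : ℕ) {κ : Type*}
    (b : Module.Basis κ ℂ ψ) (k : κ) (f : Fin n → ψ) (i : Fin n) :
    coordSlice n b k f i = b.repr (f i) k := rfl

theorem sum_coordSlice {ψ : Type*} [AddCommGroup ψ] [Module ℂ ψ] (n : ℕ) {κ : Type*} [Fintype κ]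
    (b : Module.Basis κ ℂ ψ) (f : Fin n → ψ) :
    f = ∑ k, (fun i => coordSlice n b k f i • b k) := by
  funext i
  rw [Finset.sum_apply]
  exact (b.sum_repr (f i)).symm

theorem mem_isotypic_iff {ψ : Type*} [AddCommGroup ψ] [Module ℂ ψ] (n : ℕ) {κ : Type*} [Fintype κ]
    (b : Module.Basis κ ℂ ψ) (U : Submodule ℂ (Fin n → ℂ)) (f : Fin n → ψ) :
    f ∈ isotypicCorrespondence ψ n U ↔ ∀ k, coordSlice n b k f ∈ U := by
  constructor
  · intro hf k
    have : isotypicCorrespondence ψ n U ≤ U.comap (coordSlice n b k) := by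
      refine Submodule.span_le.2 ?_
      rintro _ ⟨c, hc, v, rfl⟩
      have : coordSlice n b k (fun i => c i • v) = b.repr v k • c := by
        funext i
        simp [coordSlice_apply, mul_comm]
      change coordSlice n b k (fun i => c i • v) ∈ U
      rw [this]
      exact U.smul_mem _ hc
    exact this hf
  · intro h
    rw [sum_coordSlice n b f]
    exact Submodule.sum_mem _ fun k _ => Submodule.subset_span ⟨_, h k, b k, rfl⟩

theorem finrank_isotypic {ψ : Type*} [AddCommGroup ψ] [Module ℂ ψ] [FiniteDimensional ℂ ψ] (n : ℕ)
    (U : Submodule ℂ (Fin n → ℂ)) :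
    Module.finrank ℂ (isotypicCorrespondence ψ n U) =
      Module.finrank ℂ U * Module.finrank ℂ ψ := by
  let b := Module.finBasis ℂ ψ
  let φ : isotypicCorrespondence ψ n U →ₗ[ℂ] (Fin (Module.finrank ℂ ψ) → U) :=
    LinearMap.pi fun k => ((coordSlice n b k).comp (Submodule.subtype _)).codRestrict U
      fun f => (mem_isotypic_iff n b U f.1).1 f.2 k
  have hφ : ∀ f k, (φ f k : Fin n → ℂ) = coordSlice n b k f.1 := fun _ _ => rfl
  have hbij : Function.Bijective φ := by
    constructor
    · intro f g hfg
      apply Subtype.ext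
      rw [sum_coordSlice n b f.1, sum_coordSlice n b g.1]
      simp only [← hφ, hfg]
    · intro u
      have key : ∀ k, coordSlice n b k (fun i => ∑ l, (u l : Fin n → ℂ) i • b l) = u k := by
        intro k
        funext i
        rw [coordSlice_apply, b.repr_sum_self]
      refine ⟨⟨fun i => ∑ l, (u l : Fin n → ℂ) i • b l,
        (mem_isotypic_iff n b U _).2 fun k => ?_⟩, ?_⟩
      · rw [key]
        exact (u k).2
      · funext k
        apply Subtype.ext
        rw [hφ]
        exact key k
  rw [(LinearEquiv.ofBijective φ hbij).finrank_eq, Module.finrank_pi_fintype]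
  simp [mul_comm]

theorem isotypic_le_iff {ψ : Type*} [AddCommGroup ψ] [Module ℂ ψ] [FiniteDimensional ℂ ψ]
    [Nontrivial ψ] (n : ℕ) (U V : Submodule ℂ (Fin n → ℂ)) :
    isotypicCorrespondence ψ n U ≤ isotypicCorrespondence ψ n V ↔ U ≤ V := by
  constructor
  · intro h c hc
    let b := Module.finBasis ℂ ψ
    have k : Fin (Module.finrank ℂ ψ) := ⟨0, Module.finrank_pos⟩
    have h1 : (fun i => c i • b k) ∈ isotypicCorrespondence ψ n V :=
      h (Submodule.subset_span ⟨c, hc, b k, rfl⟩)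
    have h2 := (mem_isotypic_iff n b V _).1 h1 k
    have h3 : coordSlice n b k (fun i => c i • b k) = c := by
      funext i
      simp [coordSlice_apply]
    rwa [h3] at h2
  · intro h
    apply Submodule.span_mono
    rintro _ ⟨c, hc, v, rfl⟩
    exact ⟨c, h hc, v, rfl⟩

theorem isotypic_invariant {G ψ : Type*} [Group G] [AddCommGroup ψ] [Module ℂ ψ]
    (ρ : G →* (ψ ≃ₗ[ℂ] ψ)) (n : ℕ) (U : Submodule ℂ (Fin n → ℂ)) (g : G) :
    (isotypicCorrespondence ψ n U).map (diagMap ρ n g) = isotypicCorrespondence ψ n U := by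
  have hle : ∀ g : G, (isotypicCorrespondence ψ n U).map (diagMap ρ n g) ≤
      isotypicCorrespondence ψ n U := by
    intro g
    refine Submodule.map_le_iff_le_comap.2 (Submodule.span_le.2 ?_)
    rintro _ ⟨c, hc, v, rfl⟩
    refine Submodule.subset_span ⟨c, hc, ρ g v, ?_⟩
    funext i
    exact (ρ g).map_smul (c i) v
  refine le_antisymm (hle g) fun x hx => ?_
  refine ⟨diagMap ρ n g⁻¹ x, hle g⁻¹ ⟨x, hx, rfl⟩, ?_⟩
  funext i
  change (ρ g * ρ g⁻¹) (x i) = x i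
  rw [← map_mul]
  simp

theorem isotypic_surj {G ψ : Type*} [Group G] [AddCommGroup ψ] [Module ℂ ψ]
    [FiniteDimensional ℂ ψ] [Nontrivial ψ]
    (ρ : G →* (ψ ≃ₗ[ℂ] ψ))
    (hirr : ∀ U : Submodule ℂ ψ, (∀ g : G, U.map (ρ g).toLinearMap = U) → U = ⊥ ∨ U = ⊤)
    (n : ℕ) (W : Submodule ℂ (Fin n → ψ)) (hW : ∀ g : G, W.map (diagMap ρ n g) = W) :
    ∃ U, isotypicCorrespondence ψ n U = W := by
  have hT : ∀ T : Module.End ℂ ψ, ∀ w ∈ W, (fun i => T (w i)) ∈ W := by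
    intro T
    refine Algebra.adjoin_induction (p := fun T _ => ∀ w ∈ W, (fun i => T (w i)) ∈ W)
      ?_ ?_ ?_ ?_ (burnside_adjoin ρ hirr T)
    · rintro _ ⟨g, rfl⟩ w hw
      have : diagMap ρ n g w ∈ W.map (diagMap ρ n g) := ⟨w, hw, rfl⟩
      rw [hW g] at this
      exact this
    · intro r w hw
      exact W.smul_mem r hw
    · intro S T _ _ hS hT w hw
      exact W.add_mem (hS w hw) (hT w hw)
    · intro S T _ _ hS hT w hw
      exact hS _ (hT w hw)
  let U : Submodule ℂ (Fin n → ℂ) :=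
    { carrier := {c | ∀ v : ψ, (fun i => c i • v) ∈ W}
      zero_mem' := fun v => by
        have : (fun i => (0 : Fin n → ℂ) i • v) = 0 := by
          funext i
          simp
        rw [this]
        exact W.zero_mem
      add_mem' := fun {c d} hc hd v => by
        have : (fun i => (c + d) i • v) = (fun i => c i • v) + (fun i => d i • v) := by
          funext i
          simp [add_smul]
        rw [this]
        exact W.add_mem (hc v) (hd v)
      smul_mem' := fun r c hc v => by
        have : (fun i => (r • c) i • v) = r • (fun i => c i • v) := by
          funext i
          simp [mul_smul]
        rw [this]
        exact W.smul_mem r (hc v) }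
  refine ⟨U, le_antisymm ?_ ?_⟩
  · refine Submodule.span_le.2 ?_
    rintro _ ⟨c, hc, v, rfl⟩
    exact hc v
  · intro w hw
    let b := Module.finBasis ℂ ψ
    refine (mem_isotypic_iff n b U w).2 fun k v => ?_
    exact hT ((b.coord k).smulRight v) w hw

/-- For an irreducible representation `ψ` of `G`, the map `U ↦ Φ(U)` is an order isomorphism
from the subspaces of `ℂⁿ` onto the `G`-invariant subspaces of `n·ψ = (Fin n → ψ)` (with the
diagonal action), and it multiplies dimensions by `dim ψ`. -/
theorem invariant_subspaces_of_isotypic_equiv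
    {G ψ : Type*} [Group G] [AddCommGroup ψ] [Module ℂ ψ]
    [FiniteDimensional ℂ ψ] [Nontrivial ψ]
    (ρ : G →* (ψ ≃ₗ[ℂ] ψ))
    (hirr : ∀ U : Submodule ℂ ψ, (∀ g : G, U.map (ρ g).toLinearMap = U) → U = ⊥ ∨ U = ⊤)
    (n : ℕ) :
    ∃ e : Submodule ℂ (Fin n → ℂ) ≃o
        {W : Submodule ℂ (Fin n → ψ) // ∀ g : G, W.map (diagMap ρ n g) = W},
      ∀ U : Submodule ℂ (Fin n → ℂ),
        (e U).val = isotypicCorrespondence ψ n U ∧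
        Module.finrank ℂ (isotypicCorrespondence ψ n U) =
          Module.finrank ℂ U * Module.finrank ℂ ψ := by
  classical
  let e₀ : Submodule ℂ (Fin n → ℂ) ↪o
      {W : Submodule ℂ (Fin n → ψ) // ∀ g : G, W.map (diagMap ρ n g) = W} :=
    OrderEmbedding.ofMapLEIff
      (fun U => ⟨isotypicCorrespondence ψ n U, isotypic_invariant ρ n U⟩)
      (fun U V => isotypic_le_iff n U V)
  have hs : Function.Surjective e₀ := by
    rintro ⟨W, hW⟩
    obtain ⟨U, hU⟩ := isotypic_surj ρ hirr n W hW
    exact ⟨U, Subtype.ext hU⟩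
  exact ⟨RelIso.ofSurjective e₀ hs, fun U => ⟨rfl, finrank_isotypic n U⟩⟩
end

section
/- Let V' and V₀ be finite-dimensional complex vector spaces and let k ≤ n be natural numbers. Then the map sending W to the triple (U₀, U', f), where U₀ = W ⊓ ({0} × V₀) regarded as a subspace of V₀, U' is the image of W under the projection V' × V₀ → V', and f : U' →ₗ[ℂ] V₀ ⧸ U₀ is the well-defined linear map sending u ∈ U' to the class of v for any v ∈ V₀ with (u, v) ∈ W, is a bijection from the set {W : Submodule ℂ (V' × V₀) | finrank W = n ∧ finrank (W ⊓ ({0} × V₀)) = k} onto Σ (U₀ : {U₀ : Submodule ℂ V₀ | finrank U₀ = k}) (U' : {U' : Submodule ℂ V' | finrank U' = n - k}), (U' →ₗ[ℂ] V₀ ⧸ U₀). -/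
section StratumHelpers

variable {V' V₀ : Type*} [AddCommGroup V'] [Module ℂ V'] [AddCommGroup V₀] [Module ℂ V₀]

/-- `W ∩ ({0} × V₀)` regarded in `V₀`. -/
def strK (W : Submodule ℂ (V' × V₀)) : Submodule ℂ V₀ :=
  (W ⊓ Submodule.prod (⊥ : Submodule ℂ V') (⊤ : Submodule ℂ V₀)).map (LinearMap.snd ℂ V' V₀)

/-- The projection of W to the first factor. -/
def strP (W : Submodule ℂ (V' × V₀)) : Submodule ℂ V' := W.map (LinearMap.fst ℂ V' V₀)

theorem mem_strK (W : Submodule ℂ (V' × V₀)) (v : V₀) : v ∈ strK W ↔ ((0 : V'), v) ∈ W := by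
  simp [strK, Submodule.mem_map, Submodule.mem_prod]

theorem mem_strP (W : Submodule ℂ (V' × V₀)) (u : V') : u ∈ strP W ↔ ∃ v, (u, v) ∈ W := by
  simp [strP, Submodule.mem_map]

theorem strK_key (W : Submodule ℂ (V' × V₀)) {u : V'} {v v' : V₀} (h : (u, v) ∈ W) :
    (Submodule.Quotient.mk v' : V₀ ⧸ strK W) = Submodule.Quotient.mk v ↔ (u, v') ∈ W := by
  rw [Submodule.Quotient.eq, mem_strK]
  constructor
  · intro h'
    simpa using W.add_mem h' h
  · intro h'
    simpa using W.sub_mem h' h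

theorem exists_strF (W : Submodule ℂ (V' × V₀)) :
    ∃ f : strP W →ₗ[ℂ] V₀ ⧸ strK W, ∀ (u : V') (v : V₀),
      (u, v) ∈ W ↔ ∃ hu : u ∈ strP W, f ⟨u, hu⟩ = Submodule.Quotient.mk v := by
  have H : ∀ u : strP W, ∃ v, (u.1, v) ∈ W := fun u => (mem_strP W u.1).1 u.2
  choose g hg using H
  refine ⟨{ toFun := fun u => Submodule.Quotient.mk (g u), map_add' := ?_, map_smul' := ?_ }, ?_⟩
  · intro x y
    rw [← Submodule.Quotient.mk_add]
    exact (strK_key W (W.add_mem (hg x) (hg y))).2 (hg (x + y))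
  · intro c x
    rw [RingHom.id_apply, ← Submodule.Quotient.mk_smul]
    exact (strK_key W (W.smul_mem c (hg x))).2 (hg (c • x))
  · intro u v
    constructor
    · intro h
      have hu := (mem_strP W u).2 ⟨v, h⟩
      exact ⟨hu, (strK_key W h).2 (hg ⟨u, hu⟩)⟩
    · rintro ⟨hu, h⟩
      exact (strK_key W (hg ⟨u, hu⟩)).1 h.symm

theorem finrank_strK (W : Submodule ℂ (V' × V₀)) :
    Module.finrank ℂ (strK W) = Module.finrank ℂ
      (W ⊓ Submodule.prod (⊥ : Submodule ℂ V') (⊤ : Submodule ℂ V₀) : Submodule ℂ (V' × V₀)) := by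
  have h : W ⊓ Submodule.prod (⊥ : Submodule ℂ V') (⊤ : Submodule ℂ V₀)
      = (strK W).map (LinearMap.inr ℂ V' V₀) := by
    ext ⟨u, v⟩
    simp only [Submodule.mem_inf, Submodule.mem_prod, Submodule.mem_bot, Submodule.mem_top,
      and_true, Submodule.mem_map, LinearMap.inr_apply, Prod.mk.injEq, mem_strK]
    constructor
    · rintro ⟨h, rfl⟩
      exact ⟨v, h, rfl, rfl⟩
    · rintro ⟨_, h, rfl, rfl⟩
      exact ⟨h, rfl⟩
  rw [h]
  exact LinearEquiv.finrank_eq (Submodule.equivMapOfInjective (LinearMap.inr ℂ V' V₀)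
    LinearMap.inr_injective (strK W))

theorem finrank_str [FiniteDimensional ℂ V'] [FiniteDimensional ℂ V₀]
    (W : Submodule ℂ (V' × V₀)) :
    Module.finrank ℂ (strP W) + Module.finrank ℂ (strK W) = Module.finrank ℂ W := by
  rw [← LinearMap.finrank_range_add_finrank_ker ((LinearMap.fst ℂ V' V₀).domRestrict W),
    LinearMap.range_domRestrict]
  congr 1
  have h : (LinearMap.ker ((LinearMap.fst ℂ V' V₀).domRestrict W)).map W.subtype
      = (strK W).map (LinearMap.inr ℂ V' V₀) := by
    ext ⟨u, v⟩
    simp only [Submodule.mem_map, LinearMap.inr_apply, Prod.mk.injEq, mem_strK]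
    constructor
    · rintro ⟨⟨⟨a, b⟩, hw⟩, hk, he⟩
      simp at hk he
      obtain ⟨rfl, rfl⟩ := he
      subst hk
      exact ⟨b, hw, rfl, rfl⟩
    · rintro ⟨w, h, rfl, rfl⟩
      exact ⟨⟨_, h⟩, by simp, rfl⟩
  rw [LinearEquiv.finrank_eq (Submodule.equivMapOfInjective W.subtype W.injective_subtype
      (LinearMap.ker ((LinearMap.fst ℂ V' V₀).domRestrict W))), h]
  exact LinearEquiv.finrank_eq (Submodule.equivMapOfInjective (LinearMap.inr ℂ V' V₀)
    LinearMap.inr_injective (strK W))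

/-- The subspace attached to a triple. -/
def strG (U₀ : Submodule ℂ V₀) (U' : Submodule ℂ V') (f : U' →ₗ[ℂ] V₀ ⧸ U₀) :
    Submodule ℂ (V' × V₀) where
  carrier := {w | ∃ hu : w.1 ∈ U', f ⟨w.1, hu⟩ = Submodule.Quotient.mk w.2}
  zero_mem' := ⟨U'.zero_mem, f.map_zero⟩
  add_mem' := by
    rintro a b ⟨ha, ea⟩ ⟨hb, eb⟩
    refine ⟨U'.add_mem ha hb, ?_⟩
    rw [Prod.snd_add, Submodule.Quotient.mk_add, ← ea, ← eb, ← map_add]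
    rfl
  smul_mem' := by
    rintro c a ⟨ha, ea⟩
    refine ⟨U'.smul_mem c ha, ?_⟩
    rw [Prod.smul_snd, Submodule.Quotient.mk_smul, ← ea, ← map_smul]
    rfl

theorem mem_strG (U₀ : Submodule ℂ V₀) (U' : Submodule ℂ V') (f : U' →ₗ[ℂ] V₀ ⧸ U₀)
    (u : V') (v : V₀) : (u, v) ∈ strG U₀ U' f ↔
      ∃ hu : u ∈ U', f ⟨u, hu⟩ = Submodule.Quotient.mk v := Iff.rfl

theorem strK_strG (U₀ : Submodule ℂ V₀) (U' : Submodule ℂ V') (f : U' →ₗ[ℂ] V₀ ⧸ U₀) :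
    strK (strG U₀ U' f) = U₀ := by
  ext v
  rw [mem_strK, mem_strG]
  have h0 : f ⟨0, U'.zero_mem⟩ = 0 := f.map_zero
  constructor
  · rintro ⟨_, h⟩
    exact (Submodule.Quotient.mk_eq_zero U₀).1 (h.symm.trans h0)
  · intro h
    exact ⟨U'.zero_mem, h0.trans ((Submodule.Quotient.mk_eq_zero U₀).2 h).symm⟩

theorem strP_strG (U₀ : Submodule ℂ V₀) (U' : Submodule ℂ V') (f : U' →ₗ[ℂ] V₀ ⧸ U₀) :
    strP (strG U₀ U' f) = U' := by
  ext u
  rw [mem_strP]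
  constructor
  · rintro ⟨v, hu, _⟩
    exact hu
  · intro hu
    obtain ⟨v, hv⟩ := Submodule.Quotient.mk_surjective U₀ (f ⟨u, hu⟩)
    exact ⟨v, hu, hv.symm⟩

theorem strG_inj {p : Submodule ℂ V₀ → Prop} {q : Submodule ℂ V' → Prop}
    (s t : Σ (U₀ : {U₀ : Submodule ℂ V₀ // p U₀}) (U' : {U' : Submodule ℂ V' // q U'}),
           (U'.val →ₗ[ℂ] V₀ ⧸ U₀.val))
    (h : strG s.1.val s.2.1.val s.2.2 = strG t.1.val t.2.1.val t.2.2) : s = t := by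
  obtain ⟨⟨A, hA⟩, ⟨B, hB⟩, f⟩ := s
  obtain ⟨⟨A', hA'⟩, ⟨B', hB'⟩, f'⟩ := t
  dsimp only at h f f'
  have h1 : A = A' := by rw [← strK_strG A B f, h, strK_strG]
  have h2 : B = B' := by rw [← strP_strG A B f, h, strP_strG]
  subst h1 h2
  have h3 : f = f' := by
    ext ⟨u, hu⟩
    obtain ⟨v, hv⟩ := Submodule.Quotient.mk_surjective A (f ⟨u, hu⟩)
    have hm : (u, v) ∈ strG A B f := ⟨hu, hv.symm⟩
    rw [h] at hm
    obtain ⟨_, h'⟩ := hm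
    exact hv.symm.trans h'.symm
  rw [h3]

end StratumHelpers

/-- The `n`-dimensional subspaces `W` of `V' × V₀` with `dim (W ∩ ({0} × V₀)) = k` are in
bijection with triples `(U₀, U', f)` where `U₀ ≤ V₀` is `k`-dimensional, `U' ≤ V'` is
`(n-k)`-dimensional and `f : U' →ₗ[ℂ] V₀ ⧸ U₀`: here `U₀` is `W ∩ ({0} × V₀)` viewed in
`V₀`, `U'` is the projection of `W` to `V'`, and `f` sends `u ∈ U'` to the class of any `v`
with `(u, v) ∈ W`. -/
theorem stratum_equiv_sigma_hom_quotient
    {V' V₀ : Type*} [AddCommGroup V'] [Module ℂ V'] [FiniteDimensional ℂ V']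
    [AddCommGroup V₀] [Module ℂ V₀] [FiniteDimensional ℂ V₀]
    (n k : ℕ) (hkn : k ≤ n) :
    ∃ e : {W : Submodule ℂ (V' × V₀) //
            Module.finrank ℂ W = n ∧
            Module.finrank ℂ
              (W ⊓ Submodule.prod (⊥ : Submodule ℂ V') (⊤ : Submodule ℂ V₀) :
                Submodule ℂ (V' × V₀)) = k} ≃
        (Σ (U₀ : {U₀ : Submodule ℂ V₀ // Module.finrank ℂ U₀ = k})
           (U' : {U' : Submodule ℂ V' // Module.finrank ℂ U' = n - k}),
           (U'.val →ₗ[ℂ] V₀ ⧸ U₀.val)),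
      ∀ W, ((e W).1.val =
              (W.val ⊓ Submodule.prod (⊥ : Submodule ℂ V') (⊤ : Submodule ℂ V₀)).map
                (LinearMap.snd ℂ V' V₀)) ∧
           ((e W).2.1.val = W.val.map (LinearMap.fst ℂ V' V₀)) ∧
           (∀ (u : V') (v : V₀), (u, v) ∈ W.val →
             ∀ hu : u ∈ (e W).2.1.val,
               (e W).2.2 ⟨u, hu⟩ = Submodule.Quotient.mk v) := by
  choose F hF using fun W : Submodule ℂ (V' × V₀) => exists_strF W
  let e : {W : Submodule ℂ (V' × V₀) //
            Module.finrank ℂ W = n ∧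
            Module.finrank ℂ
              (W ⊓ Submodule.prod (⊥ : Submodule ℂ V') (⊤ : Submodule ℂ V₀) :
                Submodule ℂ (V' × V₀)) = k} →
        (Σ (U₀ : {U₀ : Submodule ℂ V₀ // Module.finrank ℂ U₀ = k})
           (U' : {U' : Submodule ℂ V' // Module.finrank ℂ U' = n - k}),
           (U'.val →ₗ[ℂ] V₀ ⧸ U₀.val)) := fun W =>
    ⟨⟨strK W.1, (finrank_strK W.1).trans W.2.2⟩, ⟨strP W.1, by
      have h1 := finrank_str W.1
      have h2 := (finrank_strK W.1).trans W.2.2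
      have h3 := W.2.1
      omega⟩, F W.1⟩
  have hG : ∀ W, strG (e W).1.val (e W).2.1.val (e W).2.2 = W.1 := by
    intro W
    ext ⟨u, v⟩
    exact (hF W.1 u v).symm
  have he : Function.Bijective e := by
    constructor
    · intro W W' h
      apply Subtype.ext
      rw [← hG W, ← hG W', h]
    · intro t
      have hK := strK_strG t.1.val t.2.1.val t.2.2
      have hP := strP_strG t.1.val t.2.1.val t.2.2
      have hd := finrank_str (strG t.1.val t.2.1.val t.2.2)
      have hk := finrank_strK (strG t.1.val t.2.1.val t.2.2)
      rw [hK, t.1.2] at hk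
      rw [hK, hP, t.1.2, t.2.1.2] at hd
      refine ⟨⟨strG t.1.val t.2.1.val t.2.2, by omega, hk.symm⟩, ?_⟩
      exact strG_inj _ _ (hG _)
  refine ⟨Equiv.ofBijective e he, fun W => ⟨rfl, rfl, ?_⟩⟩
  intro u v h hu
  obtain ⟨_, h'⟩ := (hF W.1 u v).1 h
  exact h'
end
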